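/- arXiv:2507.02402 — 3 statements merged into one kernel-verified Lean document; each statement's English description precedes it below -/
import Mathlib

section
/- Let H be a real inner product space and let a, b, c ∈ H. Define A := (3a − 4b + c)/2 and B := (3a − 2b + c)/2. Then ⟨A, B⟩ = (1/4)(‖a‖² + ‖2a − b‖² + ‖a − b‖²) − (1/4)(‖b‖² + ‖2b − c‖² + ‖b − c‖²) + (3/4)‖a − 2b + c‖². -/
open RealInnerProductSpace

/-- Identity (3.8): for the time-filter combinations
`A = (3a − 4b + c)/2` and `B = (3a − 2b + c)/2` in a real inner product space,
`⟨A, B⟩ = (1/4)(‖a‖² + ‖2a − b‖² + ‖a − b‖²)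
        − (1/4)(‖b‖² + ‖2b − c‖² + ‖b − c‖²) + (3/4)‖a − 2b + c‖²`. -/
theorem time_filter_inner_identity {H : Type*} [NormedAddCommGroup H]
    [InnerProductSpace ℝ H] (a b c : H) :
    ⟪((1 : ℝ)/2) • ((3 : ℝ) • a - (4 : ℝ) • b + c),
      ((1 : ℝ)/2) • ((3 : ℝ) • a - (2 : ℝ) • b + c)⟫
      = (1/4) * (‖a‖^2 + ‖(2 : ℝ) • a - b‖^2 + ‖a - b‖^2)
        - (1/4) * (‖b‖^2 + ‖(2 : ℝ) • b - c‖^2 + ‖b - c‖^2)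
        + (3/4) * ‖a - (2 : ℝ) • b + c‖^2 := by
  simp only [← real_inner_self_eq_norm_sq, inner_add_left, inner_add_right, inner_sub_left,
    inner_sub_right, real_inner_smul_left, real_inner_smul_right]
  rw [real_inner_comm a b, real_inner_comm a c, real_inner_comm b c]
  ring
end

section
/- Let f : ℝ → ℝ be differentiable with |f′(s)| ≤ L for all s ∈ ℝ, and let F : ℝ → ℝ satisfy F′ = f. Then for all real numbers a, b, c: |(2f(b) − f(c))·(3a − 4b + c)/2 − [F(a) − F(b)] − (1/2)[F(a) − 2F(b) + F(c)]| ≤ (3L/2)(a − b)² + (3L/2)(b − c)². -/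
lemma aux_lip (f : ℝ → ℝ) (L : ℝ)
    (hf : Differentiable ℝ f) (hL : ∀ s : ℝ, |deriv f s| ≤ L) (x y : ℝ) :
    |f y - f x| ≤ L * |y - x| := by
  have := Convex.norm_image_sub_le_of_norm_deriv_le (f := f) (s := Set.univ) (C := L)
    (fun z _ => hf z) (fun z _ => by simpa using hL z) convex_univ
    (Set.mem_univ x) (Set.mem_univ y)
  simpa using this

lemma aux_taylor (f F : ℝ → ℝ) (L : ℝ)
    (hf : Differentiable ℝ f) (hL : ∀ s : ℝ, |deriv f s| ≤ L)
    (hF : ∀ s : ℝ, HasDerivAt F (f s) s) (b x : ℝ) :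
    |F x - F b - f b * (x - b)| ≤ L / 2 * (x - b) ^ 2 := by
  have hG : ∀ t, HasDerivAt (fun t => F t - F b - f b * (t - b)) (f t - f b) t := by
    intro t
    have := ((hF t).sub_const (F b)).fun_sub (((hasDerivAt_id t).sub_const b).const_mul (f b))
    simpa using this
  have hQ : ∀ t, HasDerivAt (fun t => (t - b) ^ 2) (2 * (t - b)) t := by
    intro t
    have := ((hasDerivAt_id t).sub_const b).fun_pow 2
    simpa using this
  have key : ∃ ξ, ξ ≠ b ∧ (x - b) ^ 2 * (f ξ - f b)
      = (F x - F b - f b * (x - b)) * (2 * (ξ - b)) ∨ x = b := by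
    rcases lt_trichotomy b x with h | h | h
    · obtain ⟨ξ, hξ, e⟩ := exists_ratio_hasDerivAt_eq_ratio_slope _ _ h
        (fun t _ => (hG t).continuousAt.continuousWithinAt) (fun t _ => hG t)
        _ _ (fun t _ => (hQ t).continuousAt.continuousWithinAt) (fun t _ => hQ t)
      refine ⟨ξ, Or.inl ⟨hξ.1.ne', ?_⟩⟩
      linarith
    · exact ⟨0, Or.inr h.symm⟩
    · obtain ⟨ξ, hξ, e⟩ := exists_ratio_hasDerivAt_eq_ratio_slope _ _ h
        (fun t _ => (hG t).continuousAt.continuousWithinAt) (fun t _ => hG t)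
        _ _ (fun t _ => (hQ t).continuousAt.continuousWithinAt) (fun t _ => hQ t)
      refine ⟨ξ, Or.inl ⟨hξ.2.ne, ?_⟩⟩
      linarith
  obtain ⟨ξ, ⟨hne, e⟩ | rfl⟩ := key
  · have hp : 0 < |ξ - b| := abs_pos.mpr (sub_ne_zero.mpr hne)
    have e2 := congrArg abs e
    rw [abs_mul, abs_mul, abs_mul, abs_of_nonneg (sq_nonneg (x - b)), abs_two] at e2
    have h1 := mul_le_mul_of_nonneg_left (aux_lip f L hf hL b ξ) (sq_nonneg (x - b))
    refine le_of_mul_le_mul_right ?_ hp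
    linarith
  · simp

/-- Taylor/mean-value estimate (equations (3.14)–(3.17)): if `f` is differentiable
with `|f′| ≤ L` and `F′ = f`, then for all reals `a, b, c`:
`|(2f(b) − f(c))·(3a − 4b + c)/2 − [F(a) − F(b)] − (1/2)[F(a) − 2F(b) + F(c)]|
  ≤ (3L/2)(a − b)² + (3L/2)(b − c)²`. -/
theorem extrapolated_potential_estimate (f F : ℝ → ℝ) (L : ℝ)
    (hf : Differentiable ℝ f) (hL : ∀ s : ℝ, |deriv f s| ≤ L)
    (hF : ∀ s : ℝ, HasDerivAt F (f s) s) (a b c : ℝ) :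
    |(2 * f b - f c) * ((3 * a - 4 * b + c) / 2)
        - (F a - F b) - (1/2) * (F a - 2 * F b + F c)|
      ≤ (3 * L / 2) * (a - b)^2 + (3 * L / 2) * (b - c)^2 := by
  have hL0 : 0 ≤ L := (abs_nonneg _).trans (hL 0)
  have h1 := abs_le.mp (aux_taylor f F L hf hL hF b a)
  have h2 := abs_le.mp (aux_taylor f F L hf hL hF b c)
  have h3 := aux_lip f L hf hL c b
  have h4 : |(f b - f c) * (3 * (a - b) - (b - c))|
      ≤ L * (3 / 2 * (a - b) ^ 2 + 5 / 2 * (b - c) ^ 2) := by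
    rw [abs_mul]
    have h5 : |3 * (a - b) - (b - c)| ≤ 3 * |a - b| + |b - c| := by
      refine (abs_sub _ _).trans ?_
      rw [abs_mul, abs_of_pos (by norm_num : (0:ℝ) < 3)]
    refine (mul_le_mul h3 h5 (abs_nonneg _) (by positivity)).trans ?_
    rw [mul_assoc]
    refine mul_le_mul_of_nonneg_left ?_ hL0
    rw [← sq_abs (a - b), ← sq_abs (b - c)]
    nlinarith [sq_nonneg (|a - b| - |b - c|)]
  have h6 := abs_le.mp h4
  rw [abs_le]
  constructor <;> nlinarith [h1.1, h1.2, h2.1, h2.2, h6.1, h6.2]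
end

section
/- Let E be a real normed vector space, t ∈ ℝ, h > 0, and let w : ℝ → E be three times differentiable on the interval [t − h, t + h] with ‖w‴(s)‖ ≤ M for all s ∈ [t − h, t + h]. Then ‖(3·w(t + h) − 4·w(t) + w(t − h))/(2h) − w′(t + h)‖ ≤ M·h². -/
theorem tf_step {E : Type*} [NormedAddCommGroup E] [NormedSpace ℝ E] (L c : ℝ) (n : ℕ)
    (F F' : ℝ → E) (h0 : F 0 = 0)
    (hF : ∀ s ∈ Set.Icc 0 L, HasDerivWithinAt F (F' s) (Set.Icc 0 L) s)
    (hb : ∀ s ∈ Set.Icc 0 L, ‖F' s‖ ≤ c * ((n + 1 : ℝ) * s ^ n)) :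
    ∀ s ∈ Set.Icc 0 L, ‖F s‖ ≤ c * s ^ (n + 1) := by
  have hB : ∀ s : ℝ, HasDerivAt (fun s : ℝ => c * s ^ (n + 1)) (c * ((n + 1 : ℝ) * s ^ n)) s := by
    intro s
    have := (hasDerivAt_pow (n + 1) s).const_mul c
    simpa using this
  intro s hs
  refine image_norm_le_of_norm_deriv_right_le_deriv_boundary (f := F) (f' := F')
    (fun x hx => (hF x hx).continuousWithinAt) ?_ (by simp [h0]) hB
    (fun x hx => hb x ⟨hx.1, hx.2.le⟩) hs
  intro x hx
  refine (hF x ⟨hx.1, hx.2.le⟩).mono_of_mem_nhdsWithin ?_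
  exact Filter.mem_of_superset (Icc_mem_nhdsGE hx.2) (Set.Icc_subset_Icc_left hx.1)

theorem tf_refl {E : Type*} [NormedAddCommGroup E] [NormedSpace ℝ E] (t h : ℝ)
    (w w' : ℝ → E)
    (hw : ∀ s ∈ Set.Icc (t - h) (t + h),
      HasDerivWithinAt w (w' s) (Set.Icc (t - h) (t + h)) s) :
    ∀ s ∈ Set.Icc 0 (2 * h),
      HasDerivWithinAt (fun s => w (t + h - s)) (-w' (t + h - s)) (Set.Icc 0 (2 * h)) s := by
  intro s hs
  have hm : Set.MapsTo (fun s : ℝ => t + h - s) (Set.Icc 0 (2 * h))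
      (Set.Icc (t - h) (t + h)) := by
    intro x hx
    constructor <;> linarith [hx.1, hx.2]
  have h1 : HasDerivWithinAt (fun s : ℝ => t + h - s) (-1) (Set.Icc 0 (2 * h)) s :=
    ((hasDerivAt_id s).const_sub (t + h)).hasDerivWithinAt
  have := HasDerivWithinAt.scomp s (hw _ (hm hs)) h1 hm
  simpa [Function.comp_def] using this

/-- Second consistency estimate of Lemma 4.1 (pointwise form): if `w` is three
times differentiable on `[t − h, t + h]` with `‖w‴‖ ≤ M` there, then the BDF2-type
difference quotient `A(w(t+h))/h = (3w(t+h) − 4w(t) + w(t−h))/(2h)` satisfies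
`‖A(w(t+h))/h − w′(t+h)‖ ≤ M h²`. -/
theorem time_filter_consistency_derivative {E : Type*} [NormedAddCommGroup E]
    [NormedSpace ℝ E] (t h M : ℝ) (hh : 0 < h) (w w' w'' w''' : ℝ → E)
    (hw' : ∀ s ∈ Set.Icc (t - h) (t + h),
      HasDerivWithinAt w (w' s) (Set.Icc (t - h) (t + h)) s)
    (hw'' : ∀ s ∈ Set.Icc (t - h) (t + h),
      HasDerivWithinAt w' (w'' s) (Set.Icc (t - h) (t + h)) s)
    (hw''' : ∀ s ∈ Set.Icc (t - h) (t + h),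
      HasDerivWithinAt w'' (w''' s) (Set.Icc (t - h) (t + h)) s)
    (hM : ∀ s ∈ Set.Icc (t - h) (t + h), ‖w''' s‖ ≤ M) :
    ‖(1 / (2 * h)) • ((3 : ℝ) • w (t + h) - (4 : ℝ) • w t + w (t - h)) - w' (t + h)‖
      ≤ M * h^2 := by

  have hm : ∀ s ∈ Set.Icc 0 (2 * h), t + h - s ∈ Set.Icc (t - h) (t + h) := by
    intro x hx
    constructor <;> linarith [hx.1, hx.2]
  have d1 := tf_refl t h w w' hw'
  have d2 := tf_refl t h w' w'' hw''
  have d3 := tf_refl t h w'' w''' hw'''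
  have b2 := tf_step (2 * h) M 0 (fun s => w'' (t + h - s) - w'' (t + h)) _ (by simp)
    (fun s hs => (d3 s hs).sub_const _)
    (fun s hs => by simpa using hM _ (hm s hs))
  have b1 := tf_step (2 * h) (M / 2) 1
    (fun s => w' (t + h - s) - w' (t + h) + s • w'' (t + h))
    (fun s => -(w'' (t + h - s) - w'' (t + h))) (by simp)
    (fun s hs => by
      have e := ((d2 s hs).sub_const (w' (t + h))).add
        ((hasDerivWithinAt_id s _).smul_const (w'' (t + h)))
      refine e.congr_deriv ?_
      module)
    (fun s hs => by
      rw [norm_neg]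
      refine (b2 s hs).trans (le_of_eq ?_)
      push_cast
      ring)
  have b0 := tf_step (2 * h) (M / 6) 2
    (fun s => w (t + h - s) - w (t + h) + s • w' (t + h) - (s ^ 2) • ((1 / 2 : ℝ) • w'' (t + h)))
    (fun s => -(w' (t + h - s) - w' (t + h) + s • w'' (t + h))) (by simp)
    (fun s hs => by
      have e := (((d1 s hs).sub_const (w (t + h))).add
        ((hasDerivWithinAt_id s _).smul_const (w' (t + h)))).sub
        ((hasDerivAt_pow 2 s).hasDerivWithinAt.smul_const ((1 / 2 : ℝ) • w'' (t + h)))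
      refine e.congr_deriv ?_
      push_cast
      module)
    (fun s hs => by
      rw [norm_neg]
      refine (b1 s hs).trans (le_of_eq ?_)
      push_cast
      ring)
  have r1 := b0 h ⟨hh.le, by linarith⟩
  have r2 := b0 (2 * h) ⟨by linarith, le_rfl⟩
  have e1 : t + h - h = t := by ring
  have e2 : t + h - 2 * h = t - h := by ring
  simp only [e1, e2] at r1 r2
  set R1 := w t - w (t + h) + h • w' (t + h) - (h ^ 2) • ((1 / 2 : ℝ) • w'' (t + h)) with hR1
  set R2 := w (t - h) - w (t + h) + (2 * h) • w' (t + h)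
    - ((2 * h) ^ 2) • ((1 / 2 : ℝ) • w'' (t + h)) with hR2
  have key : (1 / (2 * h)) • ((3 : ℝ) • w (t + h) - (4 : ℝ) • w t + w (t - h)) - w' (t + h)
      = (1 / (2 * h)) • (R2 - (4 : ℝ) • R1) := by
    have : w' (t + h) = (1 / (2 * h)) • ((2 * h) • w' (t + h)) := by
      rw [smul_smul, one_div, inv_mul_cancel₀ (by positivity), one_smul]
    rw [this, ← smul_sub, hR1, hR2]
    congr 1
    module
  rw [key, norm_smul, Real.norm_of_nonneg (by positivity)]
  have n1 : ‖R2 - (4 : ℝ) • R1‖ ≤ 2 * M * h ^ 3 := by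
    refine (norm_sub_le _ _).trans ?_
    rw [norm_smul, Real.norm_of_nonneg (by norm_num)]
    norm_num at r1 r2 ⊢
    nlinarith [r1, r2]
  calc 1 / (2 * h) * ‖R2 - (4 : ℝ) • R1‖ ≤ 1 / (2 * h) * (2 * M * h ^ 3) := by gcongr
    _ = M * h ^ 2 := by field_simp
end
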